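/- Let ρ : [0,∞) → (0,∞) be continuous and nonincreasing with ∫_{ℝⁿ} ρ(|x|²) dx < ∞ and with t ↦ −log ρ(e^t) convex on ℝ, and let μ_ρ be the probability measure on ℝⁿ with density ρ(|x|²)/∫ρ(|y|²)dy with respect to Lebesgue measure. Then for all symmetric Borel probability measures ν₁, ν₂ on ℝⁿ, T_{ω_ρ}(ν₁,ν₂) ≤ H(ν₁|μ_ρ) + H(ν₂|μ_ρ), where ω_ρ(x,y) = log( ρ(x·y)² / (ρ(|x|²) ρ(|y|²)) ) if x·y ≥ 0 and ω_ρ(x,y) = +∞ otherwise. -/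

import Mathlib

open MeasureTheory Set Filter
open scoped RealInnerProductSpace ENNReal Topology

/-- The set of couplings of two measures: measures on the product whose marginals are the
given measures. -/
def Coupling {α : Type*} [MeasurableSpace α] (ν₁ ν₂ : Measure α) :
    Set (Measure (α × α)) :=
  {π | π.map Prod.fst = ν₁ ∧ π.map Prod.snd = ν₂}

/-- The optimal transport cost `T_c(ν₁,ν₂) = inf { ∫ c dπ : π coupling of ν₁ and ν₂}`. -/
noncomputable def transportCost {α : Type*} [MeasurableSpace α]
    (c : α → α → ℝ≥0∞) (ν₁ ν₂ : Measure α) : ℝ≥0∞ :=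
  ⨅ π ∈ Coupling ν₁ ν₂, ∫⁻ p, c p.1 p.2 ∂π

open Classical in
/-- Relative entropy `H(ν|μ) = ∫ log (dν/dμ) dν` if `ν ≪ μ` (and the integral exists),
`+∞` otherwise.  For probability measures the negative part of the integrand is always
integrable, so the `+∞` convention for the non-integrable case is the correct one. -/
noncomputable def relEnt {α : Type*} [MeasurableSpace α] (ν μ : Measure α) : ℝ≥0∞ :=
  if ν ≪ μ ∧ Integrable (llr ν μ) ν then ENNReal.ofReal (∫ x, llr ν μ x ∂ν) else ⊤

open scoped Pointwise in
/-- Midpoint Brunn–Minkowski inequality on the line, for compact sets. -/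
lemma volume_add_volume_le_two_mul_of_isCompact {K L M : Set ℝ} (hK : IsCompact K)
    (hL : IsCompact L) (hK0 : K.Nonempty) (hL0 : L.Nonempty)
    (h : ∀ x ∈ K, ∀ y ∈ L, (x + y) / 2 ∈ M) :
    volume K + volume L ≤ 2 * volume M := by
  obtain ⟨a, ha, hKa⟩ := hK.exists_isGreatest hK0
  obtain ⟨b, hb, hLb⟩ := hL.exists_isLeast hL0
  have key : ∀ (S : Set ℝ) (c : ℝ), volume ((fun x => (x + c) / 2) '' S) = 2⁻¹ * volume S := by
    intro S c
    have : (fun x : ℝ => (x + c) / 2) '' S = (fun x => x + c / 2) '' ((2⁻¹ : ℝ) • S) := by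
      rw [← image_smul, image_image]
      congr 1
      ext x
      simp only [smul_eq_mul]
      ring
    rw [this, image_add_right, measure_preimage_add_right, Measure.addHaar_smul]
    congr 1
    simp
  have hdisj : AEDisjoint volume ((fun x => (x + b) / 2) '' K) ((fun x => (x + a) / 2) '' L) := by
    refine measure_mono_null (t := {(a + b) / 2}) ?_ (by simp)
    rintro _ ⟨⟨x, hx, rfl⟩, y, hy, hxy⟩
    have h1 := hKa hx
    have h2 := hLb hy
    simp only [mem_singleton_iff] at *
    linarith
  have hsub : (fun x => (x + b) / 2) '' K ∪ (fun x => (x + a) / 2) '' L ⊆ M := by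
    rintro _ (⟨x, hx, rfl⟩ | ⟨y, hy, rfl⟩)
    · exact h x hx b hb
    · simpa only [add_comm] using h a ha y hy
  have h1 := measure_mono (μ := volume) hsub
  have hmeas : MeasurableSet ((fun x => (x + a) / 2) '' L) :=
    (hL.image (by fun_prop)).measurableSet
  rw [measure_union₀ hmeas.nullMeasurableSet hdisj, key, key, ← mul_add] at h1
  calc volume K + volume L = 2 * (2⁻¹ * (volume K + volume L)) := by
        rw [← mul_assoc, ENNReal.mul_inv_cancel (by simp) (by simp), one_mul]
    _ ≤ 2 * volume M := by gcongr

/-- Midpoint Brunn–Minkowski inequality on the line, for measurable sets. -/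
lemma volume_add_volume_le_two_mul {A B M : Set ℝ} (hA : MeasurableSet A)
    (hB : MeasurableSet B) (hA0 : A.Nonempty) (hB0 : B.Nonempty)
    (h : ∀ x ∈ A, ∀ y ∈ B, (x + y) / 2 ∈ M) :
    volume A + volume B ≤ 2 * volume M := by
  have key : ∀ (S : Set ℝ) (c d : ℝ≥0∞), MeasurableSet S → S.Nonempty →
      (∀ K ⊆ S, IsCompact K → K.Nonempty → volume K + c ≤ d) → volume S + c ≤ d := by
    rintro S c d hS ⟨a, ha⟩ hd
    have hcd : c ≤ d := by
      simpa using hd {a} (by simpa using ha) isCompact_singleton (singleton_nonempty a)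
    by_cases hc : c = ⊤
    · rw [hc, top_le_iff] at hcd
      simp [hcd]
    refine add_le_of_le_tsub_right_of_le hcd (le_of_forall_lt fun r hr => ?_)
    obtain ⟨K, hKS, hK, hrK⟩ := hS.exists_lt_isCompact hr
    refine hrK.trans_le (ENNReal.le_sub_of_add_le_right hc (hd K hKS hK ?_))
    rw [nonempty_iff_ne_empty]
    rintro rfl
    simp at hrK
  refine key A _ _ hA hA0 fun K hKA hK hK0 => ?_
  rw [add_comm]
  refine key B _ _ hB hB0 fun L hLB hL hL0 => ?_
  rw [add_comm]
  exact volume_add_volume_le_two_mul_of_isCompact hK hL hK0 hL0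
    fun x hx y hy => h x (hKA hx) y (hLB hy)

lemma lintegral_add_lintegral_le_two_mul {f g h : ℝ → ℝ≥0∞} (hf : Measurable f)
    (hg : Measurable g) (hh : Measurable h) (hf1 : ⨆ x, f x = 1) (hg1 : ⨆ x, g x = 1)
    (H : ∀ x y, f x * g y ≤ h ((x + y) / 2) ^ 2) :
    (∫⁻ x, f x) + ∫⁻ x, g x ≤ 2 * ∫⁻ x, h x := by
  have layer : ∀ u : ℝ → ℝ≥0∞, Measurable u → (∀ x, u x ≤ 1) →
      ∫⁻ x, u x = ∫⁻ t in Ioi (0 : ℝ), volume {x | ENNReal.ofReal t < u x} := by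
    intro u hu hu1
    have h1 := lintegral_eq_lintegral_meas_lt (f := fun x => (u x).toReal) volume
      (Eventually.of_forall fun x => ENNReal.toReal_nonneg) hu.ennreal_toReal.aemeasurable
    have h2 : ∀ x, u x ≠ ⊤ := fun x => ((hu1 x).trans_lt (by simp)).ne
    simp only [ENNReal.ofReal_toReal (h2 _)] at h1
    rw [h1]
    refine setLIntegral_congr_fun measurableSet_Ioi fun t ht => ?_
    congr 1
    ext x
    simp only [mem_ofPred_eq]
    rw [ENNReal.ofReal_lt_iff_lt_toReal (le_of_lt ht) (h2 x)]
  have meas : ∀ u : ℝ → ℝ≥0∞, Measurable fun t : ℝ => volume {x | ENNReal.ofReal t < u x} := by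
    intro u
    refine Antitone.measurable fun s t hst => measure_mono fun x hx => ?_
    exact (ENNReal.ofReal_le_ofReal hst).trans_lt hx
  have hfle : ∀ x, f x ≤ 1 := fun x => hf1 ▸ le_iSup f x
  have hgle : ∀ x, g x ≤ 1 := fun x => hg1 ▸ le_iSup g x
  calc (∫⁻ x, f x) + ∫⁻ x, g x
      = ∫⁻ t in Ioi (0 : ℝ), (volume {x | ENNReal.ofReal t < f x}
          + volume {x | ENNReal.ofReal t < g x}) := by
        rw [lintegral_add_left (meas f), layer f hf hfle, layer g hg hgle]
    _ ≤ ∫⁻ t in Ioi (0 : ℝ), 2 * volume {x | ENNReal.ofReal t < min (h x) 1} := by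
        refine lintegral_mono fun t => ?_
        by_cases ht : ENNReal.ofReal t < 1
        · refine volume_add_volume_le_two_mul (measurableSet_lt measurable_const hf)
            (measurableSet_lt measurable_const hg) ?_ ?_ ?_
          · exact lt_iSup_iff.1 (hf1 ▸ ht)
          · exact lt_iSup_iff.1 (hg1 ▸ ht)
          · intro x hx y hy
            refine lt_min ?_ ht
            have h1 : ENNReal.ofReal t ^ 2 < h ((x + y) / 2) ^ 2 := by
              refine lt_of_lt_of_le ?_ (H x y)
              rw [sq]
              exact ENNReal.mul_lt_mul hx hy
            exact lt_of_pow_lt_pow_left' 2 h1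
        · have h1 : ∀ u : ℝ → ℝ≥0∞, (∀ x, u x ≤ 1) → {x | ENNReal.ofReal t < u x} = ∅ := by
            intro u hu
            ext x
            simpa using (hu x).trans (not_lt.1 ht)
          simp [h1 f hfle, h1 g hgle]
    _ = 2 * ∫⁻ x, min (h x) 1 := by
        rw [lintegral_const_mul _ (meas _), ← layer _ (hh.min measurable_const) (by simp)]
    _ ≤ 2 * ∫⁻ x, h x := by
        gcongr
        exact min_le_left _ _

lemma ENNReal.four_mul_mul_le_add_sq (x y : ℝ≥0∞) : 4 * (x * y) ≤ (x + y) ^ 2 := by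
  by_cases hx : x = ⊤
  · simp [hx]
  by_cases hy : y = ⊤
  · simp [hy]
  lift x to NNReal using hx
  lift y to NNReal using hy
  norm_cast
  rw [← NNReal.coe_le_coe]
  push_cast
  nlinarith [sq_nonneg ((x : ℝ) - y)]

lemma prekopaLeindler_real_of_bounded {f g h : ℝ → ℝ≥0∞} (hf : Measurable f)
    (hg : Measurable g) (hh : Measurable h) (hfb : ⨆ x, f x ≠ ⊤) (hgb : ⨆ x, g x ≠ ⊤)
    (H : ∀ x y, f x * g y ≤ h ((x + y) / 2) ^ 2) :
    (∫⁻ x, f x) * ∫⁻ x, g x ≤ (∫⁻ x, h x) ^ 2 := by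
  set a := ⨆ x, f x with ha
  set b := ⨆ x, g x with hb
  by_cases ha0 : a = 0
  · have : f = 0 := by
      ext x
      have h0 := le_iSup f x
      rw [← ha, ha0] at h0
      simpa using h0
    simp [this]
  by_cases hb0 : b = 0
  · have : g = 0 := by
      ext x
      have h0 := le_iSup g x
      rw [← hb, hb0] at h0
      simpa using h0
    simp [this]
  obtain ⟨c, hc⟩ : ∃ c : ℝ≥0∞, c ^ 2 = a⁻¹ * b⁻¹ :=
    ⟨(a⁻¹ * b⁻¹) ^ (2⁻¹ : ℝ), by
      rw [← ENNReal.rpow_natCast, ← ENNReal.rpow_mul]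
      norm_num⟩
  have h1 := lintegral_add_lintegral_le_two_mul (hf.const_mul a⁻¹) (hg.const_mul b⁻¹)
    (hh.const_mul c) (by rw [← ENNReal.mul_iSup, ENNReal.inv_mul_cancel ha0 hfb])
    (by rw [← ENNReal.mul_iSup, ENNReal.inv_mul_cancel hb0 hgb]) (fun x y => by
      rw [mul_pow, hc, mul_mul_mul_comm]
      gcongr
      exact H x y)
  rw [lintegral_const_mul _ hf, lintegral_const_mul _ hg, lintegral_const_mul _ hh] at h1
  have h2 := (ENNReal.four_mul_mul_le_add_sq _ _).trans (pow_le_pow_left' h1 2)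
  rw [mul_pow, mul_pow, hc, mul_mul_mul_comm] at h2
  norm_num at h2
  rw [ENNReal.mul_le_mul_iff_right (by simp) (by simp),
    ENNReal.mul_le_mul_iff_right (by simp [hfb, hgb]) (by
      exact ENNReal.mul_ne_top (by simpa using ha0) (by simpa using hb0))] at h2
  exact h2

lemma prekopaLeindler_real {f g h : ℝ → ℝ≥0∞} (hf : Measurable f)
    (hg : Measurable g) (hh : Measurable h)
    (H : ∀ x y, f x * g y ≤ h ((x + y) / 2) ^ 2) :
    (∫⁻ x, f x) * ∫⁻ x, g x ≤ (∫⁻ x, h x) ^ 2 := by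
  have key : ∀ u : ℝ → ℝ≥0∞, Measurable u →
      ∫⁻ x, u x = ⨆ N : ℕ, ∫⁻ x, min (u x) N := by
    intro u hu
    rw [← lintegral_iSup (fun N => hu.min measurable_const)
      (fun N M hNM x => min_le_min_left _ (by exact_mod_cast hNM))]
    congr 1
    ext x
    rw [← inf_iSup_eq, ENNReal.iSup_natCast, inf_top_eq]
  rw [key f hf, key g hg, ENNReal.iSup_mul]
  refine iSup_le fun N => ?_
  rw [ENNReal.mul_iSup]
  refine iSup_le fun M => ?_
  refine prekopaLeindler_real_of_bounded (hf.min measurable_const) (hg.min measurable_const) hh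
    ?_ ?_ fun x y => le_trans ?_ (H x y)
  · exact ((iSup_le fun x => min_le_right _ _).trans_lt (ENNReal.natCast_lt_top N)).ne
  · exact ((iSup_le fun x => min_le_right _ _).trans_lt (ENNReal.natCast_lt_top M)).ne
  · gcongr
    exacts [min_le_left _ _, min_le_left _ _]

/-- `μ` satisfies a Prékopa–Leindler inequality (with weights `1/2`) along the ternary relation
`R`, where `R x y z` reads as `z` being a mean of `x` and `y`. -/
def IsPrekopaLeindler {X : Type*} [MeasurableSpace X] (μ : Measure X) (R : X → X → X → Prop) :
    Prop :=
  ∀ f g h : X → ℝ≥0∞, Measurable f → Measurable g → Measurable h →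
    (∀ x y z, R x y z → f x * g y ≤ h z ^ 2) →
    (∫⁻ x, f x ∂μ) * ∫⁻ x, g x ∂μ ≤ (∫⁻ x, h x ∂μ) ^ 2

namespace IsPrekopaLeindler

variable {X Y : Type*} [MeasurableSpace X] [MeasurableSpace Y] {μ : Measure X} {ν : Measure Y}
  {R : X → X → X → Prop} {S : Y → Y → Y → Prop}

lemma measure_mul_le (hμ : IsPrekopaLeindler μ R) {A B C : Set X} (hA : MeasurableSet A)
    (hB : MeasurableSet B) (hC : MeasurableSet C)
    (h : ∀ x ∈ A, ∀ y ∈ B, ∀ z, R x y z → z ∈ C) : μ A * μ B ≤ μ C ^ 2 := by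
  have h1 := hμ (A.indicator 1) (B.indicator 1) (C.indicator 1) (measurable_one.indicator hA)
    (measurable_one.indicator hB) (measurable_one.indicator hC) (fun x y z hR => by
      by_cases hx : x ∈ A
      · by_cases hy : y ∈ B
        · simp [hx, hy, h x hx y hy z hR]
        · simp [hy]
      · simp [hx])
  simpa [lintegral_indicator_one, hA, hB, hC] using h1

lemma prod [SFinite ν] (hμ : IsPrekopaLeindler μ R) (hν : IsPrekopaLeindler ν S) :
    IsPrekopaLeindler (μ.prod ν) (fun x y z => R x.1 y.1 z.1 ∧ S x.2 y.2 z.2) := by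
  intro f g h hf hg hh H
  rw [lintegral_prod _ hf.aemeasurable, lintegral_prod _ hg.aemeasurable,
    lintegral_prod _ hh.aemeasurable]
  refine hμ _ _ _ hf.lintegral_prod_right' hg.lintegral_prod_right' hh.lintegral_prod_right' ?_
  intro x y z hR
  exact hν _ _ _ (hf.comp measurable_prodMk_left) (hg.comp measurable_prodMk_left)
    (hh.comp measurable_prodMk_left) fun x' y' z' hS => H _ _ _ ⟨hR, hS⟩

lemma of_measurePreserving (hν : IsPrekopaLeindler ν S) (e : X ≃ᵐ Y)
    (he : MeasurePreserving e μ ν) (hRS : ∀ x y z, S (e x) (e y) (e z) → R x y z) :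
    IsPrekopaLeindler μ R := by
  intro f g h hf hg hh H
  have key : ∀ u : X → ℝ≥0∞, ∫⁻ x, u x ∂μ = ∫⁻ y, u (e.symm y) ∂ν := by
    intro u
    rw [← he.map_eq, lintegral_map_equiv]
    simp
  rw [key f, key g, key h]
  refine hν _ _ _ (hf.comp e.symm.measurable) (hg.comp e.symm.measurable)
    (hh.comp e.symm.measurable) fun x y z hS => H _ _ _ (hRS _ _ _ ?_)
  simpa using hS

lemma pi [SigmaFinite μ] (hμ : IsPrekopaLeindler μ R) (n : ℕ) :
    IsPrekopaLeindler (Measure.pi fun _ : Fin n => μ) (fun x y z => ∀ i, R (x i) (y i) (z i)) := by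
  induction n with
  | zero =>
    intro f g h hf hg hh H
    rw [Measure.pi_of_empty _ finZeroElim, lintegral_dirac, lintegral_dirac, lintegral_dirac]
    exact H _ _ _ fun i => i.elim0
  | succ n ih =>
    refine (hμ.prod ih).of_measurePreserving (MeasurableEquiv.piFinSuccAbove _ 0)
      (measurePreserving_piFinSuccAbove (fun _ => μ) 0) ?_
    rintro x y z ⟨h0, h1⟩ i
    refine Fin.cases h0 (fun j => ?_) i
    exact h1 j

lemma real : IsPrekopaLeindler (volume : Measure ℝ) (fun x y z => z = (x + y) / 2) :=
  fun _ _ _ hf hg hh H => prekopaLeindler_real hf hg hh fun x y => H x y _ rfl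

lemma Ioi : IsPrekopaLeindler ((volume : Measure ℝ).restrict (Ioi 0))
    (fun x y z => 0 < x ∧ 0 < y ∧ 0 < z ∧ z ^ 2 = x * y) := by
  intro f g h hf hg hh H
  have key : ∀ u : ℝ → ℝ≥0∞,
      ∫⁻ x in Set.Ioi 0, u x = ∫⁻ a, ENNReal.ofReal (Real.exp a) * u (Real.exp a) := by
    intro u
    have h1 := lintegral_image_eq_lintegral_abs_deriv_mul (s := univ) MeasurableSet.univ
      (fun x _ => (Real.hasDerivAt_exp x).hasDerivWithinAt) Real.exp_injective.injOn u
    simpa [Real.range_exp] using h1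
  have meas : ∀ u : ℝ → ℝ≥0∞, Measurable u →
      Measurable fun a => ENNReal.ofReal (Real.exp a) * u (Real.exp a) := by
    intro u hu
    fun_prop
  rw [key f, key g, key h]
  refine real _ _ _ (meas f hf) (meas g hg) (meas h hh) ?_
  rintro x y _ rfl
  have h1 : Real.exp ((x + y) / 2) ^ 2 = Real.exp x * Real.exp y := by
    rw [← Real.exp_add, ← Real.exp_nat_mul]
    congr 1
    push_cast
    ring
  rw [mul_mul_mul_comm, mul_pow, ← ENNReal.ofReal_mul (Real.exp_pos x).le, ← h1,
    ENNReal.ofReal_pow (Real.exp_pos _).le]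
  gcongr
  exact H _ _ _ ⟨Real.exp_pos _, Real.exp_pos _, Real.exp_pos _, h1⟩

lemma real_sq : IsPrekopaLeindler (volume : Measure ℝ) (fun x y z => z ^ 2 = |x| * |y|) := by
  intro f g h hf hg hh H
  have key : ∀ u : ℝ → ℝ≥0∞, Measurable u →
      ∫⁻ x, u x = ∫⁻ x in Set.Ioi 0, (u x + u (-x)) := by
    intro u hu
    rw [lintegral_add_left hu, ← lintegral_add_compl u (measurableSet_Ioi (a := (0 : ℝ)))]
    congr 1
    have h1 := (Measure.measurePreserving_neg (volume : Measure ℝ)).setLIntegral_comp_preimage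
      (measurableSet_Iio (a := (0 : ℝ))) hu
    rw [compl_Ioi, setLIntegral_congr Iio_ae_eq_Iic.symm, ← h1]
    simp
  have hhm : Measurable fun x => 2 * min (h x) (h (-x)) :=
    (hh.min (hh.comp measurable_neg)).const_mul 2
  have h2 : ∫⁻ x in Set.Ioi 0, 2 * min (h x) (h (-x)) ≤ ∫⁻ x, h x := by
    rw [key h hh]
    refine lintegral_mono fun x => ?_
    rw [two_mul]
    exact add_le_add (min_le_left _ _) (min_le_right _ _)
  refine le_trans ?_ (pow_le_pow_left' h2 2)
  rw [key f hf, key g hg]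
  refine Ioi _ _ _ (hf.add (hf.comp measurable_neg)) (hg.add (hg.comp measurable_neg)) hhm ?_
  rintro x y z ⟨hx, hy, hz, hxy⟩
  have h3 : ∀ x' y', |x'| = x → |y'| = y → f x' * g y' ≤ min (h z) (h (-z)) ^ 2 := by
    intro x' y' hx' hy'
    rcases min_choice (h z) (h (-z)) with h4 | h4 <;> rw [h4] <;> refine H _ _ _ ?_
    · simp only [hx', hy', hxy]
    · simp only [hx', hy', neg_sq, hxy]
  have hx1 := abs_of_pos hx
  have hy1 := abs_of_pos hy
  have hx2 : |-x| = x := by rw [abs_neg, hx1]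
  have hy2 : |-y| = y := by rw [abs_neg, hy1]
  calc (f x + f (-x)) * (g y + g (-y))
      = f x * g y + f x * g (-y) + (f (-x) * g y + f (-x) * g (-y)) := by ring
    _ ≤ min (h z) (h (-z)) ^ 2 + min (h z) (h (-z)) ^ 2
        + (min (h z) (h (-z)) ^ 2 + min (h z) (h (-z)) ^ 2) := by
        gcongr <;> apply h3 <;> assumption
    _ = (2 * min (h z) (h (-z))) ^ 2 := by ring

end IsPrekopaLeindler

section Symmetrization

variable {n : ℕ}

/-- Reflection of `ℝⁿ` flipping the sign of the `i`-th coordinate. -/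
def flipCoord (i : Fin n) (x : Fin n → ℝ) : Fin n → ℝ := Function.update x i (-x i)

@[simp] lemma flipCoord_same (i : Fin n) (x : Fin n → ℝ) : flipCoord i x i = -x i := by
  simp [flipCoord]

lemma flipCoord_of_ne {i j : Fin n} (h : j ≠ i) (x : Fin n → ℝ) : flipCoord i x j = x j := by
  simp [flipCoord, h]

lemma continuous_flipCoord (i : Fin n) : Continuous (flipCoord i) :=
  continuous_id.update i (continuous_apply i).neg

/-- The average of `x` and of the reflection of `y` in the `i`-th coordinate. -/
noncomputable def flipMean (i : Fin n) (x y : Fin n → ℝ) : Fin n → ℝ :=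
  (2⁻¹ : ℝ) • (x + flipCoord i y)

lemma flipMean_same (i : Fin n) (x y : Fin n → ℝ) : flipMean i x y i = (x i - y i) / 2 := by
  simp [flipMean]
  ring

lemma flipMean_of_ne {i j : Fin n} (h : j ≠ i) (x y : Fin n → ℝ) :
    flipMean i x y j = (x j + y j) / 2 := by
  simp [flipMean, flipCoord_of_ne h]
  ring

lemma continuous_flipMean (i : Fin n) :
    Continuous fun p : (Fin n → ℝ) × (Fin n → ℝ) => flipMean i p.1 p.2 := by
  have := continuous_flipCoord i
  unfold flipMean
  fun_prop

lemma neg_flipMean (i : Fin n) (x y : Fin n → ℝ) : -flipMean i x y = flipMean i (-x) (-y) := by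
  ext k
  rcases eq_or_ne k i with rfl | hk
  · simp only [Pi.neg_apply, flipMean_same]
    ring
  · simp only [Pi.neg_apply, flipMean_of_ne hk]
    ring

lemma flipCoord_flipMean_same (i : Fin n) (x y : Fin n → ℝ) :
    flipCoord i (flipMean i x y) = flipMean i y x := by
  ext k
  rcases eq_or_ne k i with rfl | hk
  · simp only [flipCoord_same, flipMean_same]
    ring
  · simp only [flipCoord_of_ne hk, flipMean_of_ne hk]
    ring

lemma flipCoord_flipMean_of_ne {i j : Fin n} (h : j ≠ i) (x y : Fin n → ℝ) :
    flipCoord j (flipMean i x y) = flipMean i (flipCoord j x) (flipCoord j y) := by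
  ext k
  rcases eq_or_ne k i with rfl | hk
  · simp only [flipCoord_of_ne h.symm, flipMean_same]
  · rcases eq_or_ne k j with rfl | hj
    · simp only [flipCoord_same, flipMean_of_ne hk]
      ring
    · simp only [flipCoord_of_ne hj, flipMean_of_ne hk]

/-- Steiner symmetrization (with averages) of `A` in the direction of the `i`-th axis. -/
def steiner (i : Fin n) (A : Set (Fin n → ℝ)) : Set (Fin n → ℝ) :=
  (fun p : (Fin n → ℝ) × (Fin n → ℝ) => flipMean i p.1 p.2) ''
    (A ×ˢ A ∩ {p | ∀ j, j ≠ i → p.1 j = p.2 j})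

/-- The operation on the polar side matching `steiner`: each slice orthogonal to the `i`-th axis is
averaged with the opposite slice. -/
def dualSteiner (i : Fin n) (A : Set (Fin n → ℝ)) : Set (Fin n → ℝ) :=
  (fun p : (Fin n → ℝ) × (Fin n → ℝ) => flipMean i p.1 p.2) ''
    (A ×ˢ A ∩ {p | p.2 i = -p.1 i})

lemma isCompact_steiner (i : Fin n) {A : Set (Fin n → ℝ)} (hA : IsCompact A) :
    IsCompact (steiner i A) := by
  refine ((hA.prod hA).inter_right ?_).image (continuous_flipMean i)
  simp only [ofPred_forall]
  exact isClosed_iInter fun j => isClosed_iInter fun _ =>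
    isClosed_eq (by fun_prop) (by fun_prop)

lemma isCompact_dualSteiner (i : Fin n) {A : Set (Fin n → ℝ)} (hA : IsCompact A) :
    IsCompact (dualSteiner i A) :=
  ((hA.prod hA).inter_right (isClosed_eq (by fun_prop) (by fun_prop))).image
    (continuous_flipMean i)

lemma neg_mem_steiner {i : Fin n} {A : Set (Fin n → ℝ)} (hA : ∀ x ∈ A, -x ∈ A) :
    ∀ x ∈ steiner i A, -x ∈ steiner i A := by
  rintro _ ⟨⟨x, y⟩, ⟨⟨hx, hy⟩, h⟩, rfl⟩
  exact ⟨(-x, -y), ⟨⟨hA x hx, hA y hy⟩, fun j hj => by simpa using h j hj⟩,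
    (neg_flipMean i x y).symm⟩

lemma neg_mem_dualSteiner {i : Fin n} {A : Set (Fin n → ℝ)} (hA : ∀ x ∈ A, -x ∈ A) :
    ∀ x ∈ dualSteiner i A, -x ∈ dualSteiner i A := by
  rintro _ ⟨⟨x, y⟩, ⟨⟨hx, hy⟩, h⟩, rfl⟩
  have h1 : y i = -x i := h
  exact ⟨(-x, -y), ⟨⟨hA x hx, hA y hy⟩, by simp [h1]⟩, (neg_flipMean i x y).symm⟩

lemma flipCoord_mem_steiner {i j : Fin n} {A : Set (Fin n → ℝ)}
    (hA : j ≠ i → ∀ x ∈ A, flipCoord j x ∈ A) :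
    ∀ x ∈ steiner i A, flipCoord j x ∈ steiner i A := by
  rintro _ ⟨⟨x, y⟩, ⟨⟨hx, hy⟩, h⟩, rfl⟩
  rcases eq_or_ne j i with rfl | hj
  · exact ⟨(y, x), ⟨⟨hy, hx⟩, fun k hk => (h k hk).symm⟩, (flipCoord_flipMean_same j x y).symm⟩
  · refine ⟨(flipCoord j x, flipCoord j y), ⟨⟨hA hj x hx, hA hj y hy⟩, fun k hk => ?_⟩,
      (flipCoord_flipMean_of_ne hj x y).symm⟩
    have h1 : x k = y k := h k hk
    rcases eq_or_ne k j with rfl | hkj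
    · simp [h1]
    · simp [flipCoord_of_ne hkj, h1]

lemma flipCoord_mem_dualSteiner {i j : Fin n} {A : Set (Fin n → ℝ)}
    (hA : j ≠ i → ∀ x ∈ A, flipCoord j x ∈ A) :
    ∀ x ∈ dualSteiner i A, flipCoord j x ∈ dualSteiner i A := by
  rintro _ ⟨⟨x, y⟩, ⟨⟨hx, hy⟩, h⟩, rfl⟩
  have h1 : y i = -x i := h
  rcases eq_or_ne j i with rfl | hj
  · exact ⟨(y, x), ⟨⟨hy, hx⟩, by simp [h1]⟩, (flipCoord_flipMean_same j x y).symm⟩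
  · refine ⟨(flipCoord j x, flipCoord j y), ⟨⟨hA hj x hx, hA hj y hy⟩, ?_⟩,
      (flipCoord_flipMean_of_ne hj x y).symm⟩
    simp [flipCoord_of_ne hj.symm, h1]

lemma dotProduct_mem_of_mem_steiner {i : Fin n} {A B : Set (Fin n → ℝ)} {J : Set ℝ}
    (hJ : IsLowerSet J) (h : ∀ x ∈ A, ∀ y ∈ B, x ⬝ᵥ y ∈ J) :
    ∀ x ∈ steiner i A, ∀ y ∈ dualSteiner i B, x ⬝ᵥ y ∈ J := by
  rintro _ ⟨⟨x, x'⟩, ⟨⟨hx, hx'⟩, hxx⟩, rfl⟩ _ ⟨⟨y, y'⟩, ⟨⟨hy, hy'⟩, hyy⟩, rfl⟩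
  have key : flipMean i x x' ⬝ᵥ flipMean i y y' = (x ⬝ᵥ y + x' ⬝ᵥ y') / 2 := by
    simp only [dotProduct]
    rw [← Finset.sum_add_distrib, Finset.sum_div]
    refine Finset.sum_congr rfl fun k _ => ?_
    have h1 : y' i = -y i := hyy
    rcases eq_or_ne k i with rfl | hk
    · rw [flipMean_same, flipMean_same, h1]
      ring
    · have h2 : x k = x' k := hxx k hk
      rw [flipMean_of_ne hk, flipMean_of_ne hk, h2]
      ring
  simp only [key]
  rcases le_total (x ⬝ᵥ y) (x' ⬝ᵥ y') with h1 | h1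
  · exact hJ (by linarith) (h x' hx' y' hy')
  · exact hJ (by linarith) (h x hx y hy)

lemma volume_eq_lintegral_volume_line (i : Fin (n + 1)) {A : Set (Fin (n + 1) → ℝ)}
    (hA : MeasurableSet A) :
    volume A = ∫⁻ y : Fin n → ℝ, volume {s : ℝ | i.insertNth s y ∈ A} := by
  have h1 := (volume_preserving_piFinSuccAbove (fun _ => ℝ) i).symm.measure_preimage
    hA.nullMeasurableSet
  rw [← h1, Measure.volume_eq_prod, Measure.prod_apply_symm
    ((MeasurableEquiv.piFinSuccAbove (fun _ => ℝ) i).symm.measurable hA)]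
  rfl

lemma volume_eq_lintegral_volume_slice (i : Fin (n + 1)) {A : Set (Fin (n + 1) → ℝ)}
    (hA : MeasurableSet A) :
    volume A = ∫⁻ s : ℝ, volume {y : Fin n → ℝ | i.insertNth s y ∈ A} := by
  have h1 := (volume_preserving_piFinSuccAbove (fun _ => ℝ) i).symm.measure_preimage
    hA.nullMeasurableSet
  rw [← h1, Measure.volume_eq_prod, Measure.prod_apply
    ((MeasurableEquiv.piFinSuccAbove (fun _ => ℝ) i).symm.measurable hA)]
  rfl

lemma measurable_insertNth_left (i : Fin (n + 1)) (y : Fin n → ℝ) :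
    Measurable fun s : ℝ => (i.insertNth s y : Fin (n + 1) → ℝ) :=
  (MeasurableEquiv.piFinSuccAbove (fun _ => ℝ) i).symm.measurable.comp measurable_prodMk_right

lemma measurable_insertNth_right (i : Fin (n + 1)) (s : ℝ) :
    Measurable fun y : Fin n → ℝ => (i.insertNth s y : Fin (n + 1) → ℝ) :=
  (MeasurableEquiv.piFinSuccAbove (fun _ => ℝ) i).symm.measurable.comp measurable_prodMk_left

lemma volume_le_volume_steiner (i : Fin n) {A : Set (Fin n → ℝ)} (hA : IsCompact A) :
    volume A ≤ volume (steiner i A) := by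
  cases n with
  | zero => exact i.elim0
  | succ m =>
    have hA' := (isCompact_steiner i hA).measurableSet
    rw [volume_eq_lintegral_volume_line i hA.measurableSet, volume_eq_lintegral_volume_line i hA']
    refine lintegral_mono fun y => ?_
    have hS : MeasurableSet {s : ℝ | (i.insertNth s y : Fin (m + 1) → ℝ) ∈ A} :=
      measurable_insertNth_left i y hA.measurableSet
    have h1 := IsPrekopaLeindler.real.measure_mul_le hS hS.neg
      (measurable_insertNth_left i y hA') (by
        rintro s hs t ht _ rfl
        refine ⟨(i.insertNth s y, i.insertNth (-t) y), ⟨⟨hs, ht⟩, fun j hj => ?_⟩, ?_⟩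
        · obtain ⟨k, rfl⟩ := Fin.exists_succAbove_eq hj
          simp
        · ext j
          rcases eq_or_ne j i with rfl | hj
          · simp [flipMean_same]
          · obtain ⟨k, rfl⟩ := Fin.exists_succAbove_eq hj
            simp [flipMean_of_ne hj])
    rw [Measure.measure_neg, ← sq] at h1
    exact (ENNReal.pow_le_pow_left_iff two_ne_zero).1 h1

lemma volume_le_volume_dualSteiner (i : Fin n) {A : Set (Fin n → ℝ)} (hA : IsCompact A)
    (hAneg : ∀ x ∈ A, -x ∈ A) : volume A ≤ volume (dualSteiner i A) := by
  cases n with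
  | zero => exact i.elim0
  | succ m =>
    have hA' := (isCompact_dualSteiner i hA).measurableSet
    rw [volume_eq_lintegral_volume_slice i hA.measurableSet,
      volume_eq_lintegral_volume_slice i hA']
    refine lintegral_mono fun s => ?_
    have hS : MeasurableSet {y : Fin m → ℝ | (i.insertNth s y : Fin (m + 1) → ℝ) ∈ A} :=
      measurable_insertNth_right i s hA.measurableSet
    have h1 := (IsPrekopaLeindler.real.pi m).measure_mul_le hS hS.neg
      (measurable_insertNth_right i s hA') (by
        intro y hy y' hy' z hz
        refine ⟨(i.insertNth s y, i.insertNth (-s) y'), ⟨⟨hy, ?_⟩, ?_⟩, ?_⟩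
        · have h2 := hAneg _ hy'
          rwa [show -(i.insertNth s (-y') : Fin (m + 1) → ℝ) = i.insertNth (-s) y' by
            ext j
            rcases eq_or_ne j i with rfl | hj
            · simp
            · obtain ⟨k, rfl⟩ := Fin.exists_succAbove_eq hj
              simp] at h2
        · simp
        · ext j
          rcases eq_or_ne j i with rfl | hj
          · simp [flipMean_same]
          · obtain ⟨k, rfl⟩ := Fin.exists_succAbove_eq hj
            simp [flipMean_of_ne hj, hz])
    rw [← volume_pi, Measure.measure_neg, ← sq] at h1
    exact (ENNReal.pow_le_pow_left_iff two_ne_zero).1 h1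

/-- Every pair of symmetric compact sets with prescribed scalar products can be replaced by a pair
of larger sets that are invariant under the given coordinate reflections. -/
lemma exists_flipCoord_invariant {A B : Set (Fin n → ℝ)} {J : Set ℝ} (hJ : IsLowerSet J)
    (hA : IsCompact A) (hB : IsCompact B) (hAneg : ∀ x ∈ A, -x ∈ A) (hBneg : ∀ x ∈ B, -x ∈ B)
    (h : ∀ x ∈ A, ∀ y ∈ B, x ⬝ᵥ y ∈ J) (s : Finset (Fin n)) :
    ∃ A' B' : Set (Fin n → ℝ), IsCompact A' ∧ IsCompact B' ∧ (∀ x ∈ A', -x ∈ A') ∧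
      (∀ x ∈ B', -x ∈ B') ∧ (∀ x ∈ A', ∀ y ∈ B', x ⬝ᵥ y ∈ J) ∧ volume A ≤ volume A' ∧
      volume B ≤ volume B' ∧ (∀ i ∈ s, ∀ x ∈ A', flipCoord i x ∈ A') ∧
      ∀ i ∈ s, ∀ x ∈ B', flipCoord i x ∈ B' := by
  induction s using Finset.induction_on with
  | empty => exact ⟨A, B, hA, hB, hAneg, hBneg, h, le_rfl, le_rfl, by simp, by simp⟩
  | insert i s hi ih =>
    obtain ⟨A', B', hA', hB', hA'neg, hB'neg, h', hAA', hBB', hsA, hsB⟩ := ih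
    refine ⟨steiner i A', dualSteiner i B', isCompact_steiner i hA', isCompact_dualSteiner i hB',
      neg_mem_steiner hA'neg, neg_mem_dualSteiner hB'neg, dotProduct_mem_of_mem_steiner hJ h',
      hAA'.trans (volume_le_volume_steiner i hA'),
      hBB'.trans (volume_le_volume_dualSteiner i hB' hB'neg), fun j hj => ?_, fun j hj => ?_⟩
    · exact flipCoord_mem_steiner fun hji => hsA j ((Finset.mem_insert.1 hj).resolve_left hji)
    · exact flipCoord_mem_dualSteiner fun hji => hsB j ((Finset.mem_insert.1 hj).resolve_left hji)

lemma abs_mem_of_flipCoord_mem {A : Set (Fin n → ℝ)} (hA : ∀ i, ∀ x ∈ A, flipCoord i x ∈ A)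
    {x : Fin n → ℝ} (hx : x ∈ A) : (fun i => |x i|) ∈ A := by
  have key : ∀ s : Finset (Fin n), (fun i => if i ∈ s then |x i| else x i) ∈ A := by
    intro s
    induction s using Finset.induction_on with
    | empty => simpa using hx
    | insert i s hi ih =>
      rcases abs_choice (x i) with h | h
      · convert ih using 2 with j
        rcases eq_or_ne j i with rfl | hj
        · simp [h]
        · simp [hj]
      · convert hA i _ ih using 1
        ext j
        rcases eq_or_ne j i with rfl | hj
        · simp [h, hi]
        · simp [hj, flipCoord_of_ne hj]
  simpa using key Finset.univ

lemma blaschkeSantalo_of_isCompact {A B : Set (Fin n → ℝ)} {J : Set ℝ} (hJ : IsLowerSet J)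
    (hA : IsCompact A) (hB : IsCompact B) (hAneg : ∀ x ∈ A, -x ∈ A) (hBneg : ∀ x ∈ B, -x ∈ B)
    (h : ∀ x ∈ A, ∀ y ∈ B, x ⬝ᵥ y ∈ J) :
    volume A * volume B ≤ volume {z : Fin n → ℝ | z ⬝ᵥ z ∈ J} ^ 2 := by
  obtain ⟨A', B', hA', hB', -, -, h', hAA', hBB', hsA, hsB⟩ :=
    exists_flipCoord_invariant hJ hA hB hAneg hBneg h Finset.univ
  refine (mul_le_mul' hAA' hBB').trans ?_
  have hm : MeasurableSet {z : Fin n → ℝ | z ⬝ᵥ z ∈ J} := by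
    have : Measurable fun z : Fin n → ℝ => z ⬝ᵥ z := by
      unfold dotProduct
      fun_prop
    exact this hJ.ordConnected.measurableSet
  refine (IsPrekopaLeindler.real_sq.pi n).measure_mul_le hA'.measurableSet hB'.measurableSet hm ?_
  intro x hx y hy z hz
  have h1 := h' _ (abs_mem_of_flipCoord_mem (fun i => hsA i (Finset.mem_univ i)) hx) _
    (abs_mem_of_flipCoord_mem (fun i => hsB i (Finset.mem_univ i)) hy)
  have h2 : z ⬝ᵥ z = (fun i => |x i|) ⬝ᵥ (fun i => |y i|) :=
    Finset.sum_congr rfl fun i _ => by rw [← sq, hz i]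
  simpa only [mem_ofPred_eq, h2] using h1

/-- The **Blaschke–Santaló inequality** for symmetric measurable sets: if all scalar products
between points of `A` and `B` lie in a lower set `J`, then `|A||B| ≤ |{z : |z|² ∈ J}|²`. -/
lemma blaschkeSantalo {A B : Set (Fin n → ℝ)} {J : Set ℝ} (hJ : IsLowerSet J)
    (hA : MeasurableSet A) (hB : MeasurableSet B) (hAneg : ∀ x ∈ A, -x ∈ A)
    (hBneg : ∀ x ∈ B, -x ∈ B) (h : ∀ x ∈ A, ∀ y ∈ B, x ⬝ᵥ y ∈ J) :
    volume A * volume B ≤ volume {z : Fin n → ℝ | z ⬝ᵥ z ∈ J} ^ 2 := by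
  have key : ∀ S : Set (Fin n → ℝ), (∀ x ∈ S, -x ∈ S) → ∀ K ⊆ S, IsCompact K →
      ∃ K' ⊆ S, IsCompact K' ∧ (∀ x ∈ K', -x ∈ K') ∧ volume K ≤ volume K' := by
    intro S hS K hK hKc
    refine ⟨K ∪ -K, union_subset hK fun x hx => ?_, hKc.union hKc.neg, ?_,
      measure_mono subset_union_left⟩
    · simpa using hS _ (hK hx)
    · rintro x (hx | hx)
      · exact Or.inr (by simpa using hx)
      · exact Or.inl hx
  rw [hA.measure_eq_iSup_isCompact, hB.measure_eq_iSup_isCompact]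
  simp only [ENNReal.iSup_mul, ENNReal.mul_iSup]
  refine iSup_le fun L => iSup_le fun hL => iSup_le fun hLc => iSup_le fun K => iSup_le fun hK =>
    iSup_le fun hKc => ?_
  obtain ⟨K', hK', hKc', hKneg, hKK⟩ := key A hAneg K hK hKc
  obtain ⟨L', hL', hLc', hLneg, hLL⟩ := key B hBneg L hL hLc
  exact (mul_le_mul' hKK hLL).trans (blaschkeSantalo_of_isCompact hJ hKc' hLc' hKneg hLneg
    fun x hx y hy => h x (hK' hx) y (hL' hy))

end Symmetrization

section Functional

variable {n : ℕ}

/-- The functional **Blaschke–Santaló inequality** for even functions. -/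
lemma functional_blaschkeSantalo {ρ : ℝ → ℝ} (hρpos : ∀ t, 0 ≤ t → 0 < ρ t)
    (hρanti : AntitoneOn ρ (Ici 0)) {f g : EuclideanSpace ℝ (Fin n) → ℝ} (hf : Measurable f)
    (hg : Measurable g) (hf0 : ∀ x, 0 ≤ f x) (hg0 : ∀ x, 0 ≤ g x) (hfe : ∀ x, f (-x) = f x)
    (hge : ∀ x, g (-x) = g x) (h : ∀ x y, 0 ≤ ⟪x, y⟫ → f x * g y ≤ ρ ⟪x, y⟫ ^ 2) :
    (∫⁻ x, ENNReal.ofReal (f x)) * ∫⁻ x, ENNReal.ofReal (g x)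
      ≤ (∫⁻ x : EuclideanSpace ℝ (Fin n), ENNReal.ofReal (ρ (‖x‖ ^ 2))) ^ 2 := by
  have hρm : Antitone fun u => ρ (max u 0) := fun u v huv =>
    hρanti (mem_Ici.2 (le_max_right _ _)) (mem_Ici.2 (le_max_right _ _)) (max_le_max_right 0 huv)
  have hρm' : Measurable fun x : EuclideanSpace ℝ (Fin n) => ρ (‖x‖ ^ 2) := by
    have h1 : Measurable fun x : EuclideanSpace ℝ (Fin n) => ρ (max (‖x‖ ^ 2) 0) :=
      hρm.measurable.comp (by fun_prop)
    simpa [sq_nonneg] using h1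
  rw [lintegral_eq_lintegral_meas_le _ (Eventually.of_forall hf0) hf.aemeasurable,
    lintegral_eq_lintegral_meas_le _ (Eventually.of_forall hg0) hg.aemeasurable,
    lintegral_eq_lintegral_meas_le _
      (Eventually.of_forall fun x => (hρpos _ (sq_nonneg _)).le) hρm'.aemeasurable]
  have meas : ∀ u : EuclideanSpace ℝ (Fin n) → ℝ, Measurable fun t : ℝ => volume {x | t ≤ u x} :=
    fun u => Antitone.measurable fun s t hst => measure_mono fun x hx => hst.trans hx
  refine IsPrekopaLeindler.Ioi _ _ _ (meas f) (meas g) (meas _) ?_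
  rintro r s t ⟨hr, hs, ht, hrs⟩
  have hvol : ∀ S : Set (EuclideanSpace ℝ (Fin n)), MeasurableSet S →
      volume S = volume {x : Fin n → ℝ | WithLp.toLp 2 x ∈ S} := fun S hS =>
    ((PiLp.volume_preserving_toLp (Fin n)).measure_preimage hS.nullMeasurableSet).symm
  have hmeas : ∀ S : Set (EuclideanSpace ℝ (Fin n)), MeasurableSet S →
      MeasurableSet {x : Fin n → ℝ | WithLp.toLp 2 x ∈ S} := fun S hS =>
    (PiLp.volume_preserving_toLp (Fin n)).measurable hS
  have hfm := measurableSet_le (measurable_const (a := r)) hf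
  have hgm := measurableSet_le (measurable_const (a := s)) hg
  rw [hvol _ hfm, hvol _ hgm, hvol _ (measurableSet_le measurable_const hρm')]
  have hinner : ∀ x y : Fin n → ℝ, ⟪WithLp.toLp 2 x, WithLp.toLp 2 y⟫ = x ⬝ᵥ y := by
    intro x y
    simp [PiLp.inner_apply, dotProduct, mul_comm]
  have h1 := blaschkeSantalo (J := {u | t ≤ ρ (max u 0)}) (fun u v huv hu => le_trans hu (hρm huv))
    (hmeas _ hfm) (hmeas _ hgm) ?_ ?_ ?_
  · refine h1.trans_eq ?_
    congr 2
    ext z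
    simp only [mem_ofPred_eq]
    rw [← hinner, real_inner_self_eq_norm_sq, max_eq_left (sq_nonneg _)]
  · intro x hx
    simpa [hfe] using hx
  · intro x hx
    simpa [hge] using hx
  · intro x hx y hy
    have hx' : r ≤ f (WithLp.toLp 2 x) := hx
    have hy' : s ≤ g (WithLp.toLp 2 y) := hy
    have key : ∀ x' : EuclideanSpace ℝ (Fin n), r ≤ f x' → 0 ≤ ⟪x', WithLp.toLp 2 y⟫ →
        t ≤ ρ ⟪x', WithLp.toLp 2 y⟫ := by
      intro x' hx' h0
      refine le_of_sq_le_sq ?_ (hρpos _ h0).le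
      rw [hrs]
      exact (mul_le_mul hx' hy' hs.le (hf0 _)).trans (h _ _ h0)
    simp only [mem_ofPred_eq, ← hinner]
    rcases le_total 0 ⟪WithLp.toLp 2 x, WithLp.toLp 2 y⟫ with h0 | h0
    · rw [max_eq_left h0]
      exact key _ hx' h0
    · rw [max_eq_right h0]
      refine (key (-WithLp.toLp 2 x) (by rwa [hfe]) (by simpa [inner_neg_left] using h0)).trans ?_
      refine hρanti self_mem_Ici ?_ ?_ <;> simpa [inner_neg_left] using h0

end Functional

section Duality

open scoped BoundedContinuousFunction
open CompactlySupported

/-- A positive functional on bounded continuous functions that is tight, in the sense that it is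
approximated from compactly supported functions, is represented by a finite measure. -/
lemma exists_measure_integral_eq {Y : Type*} [TopologicalSpace Y] [T2Space Y]
    [LocallyCompactSpace Y] [MeasurableSpace Y] [BorelSpace Y] (L : (Y →ᵇ ℝ) →ₗ[ℝ] ℝ)
    (hL : ∀ u : Y →ᵇ ℝ, (∀ y, 0 ≤ u y) → 0 ≤ L u) (χ : ℕ → C_c(Y, ℝ)) (hχ0 : ∀ k y, 0 ≤ χ k y)
    (hχ1 : ∀ k y, χ k y ≤ 1) (hχ : ∀ y, Tendsto (fun k => χ k y) atTop (𝓝 1))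
    (htight : Tendsto (fun k => L (χ k).toBoundedContinuousFunction) atTop (𝓝 (L 1))) :
    ∃ π : Measure Y, IsFiniteMeasure π ∧ ∀ u : Y →ᵇ ℝ, ∫ y, u y ∂π = L u := by
  have hmono : ∀ u v : Y →ᵇ ℝ, (∀ y, u y ≤ v y) → L u ≤ L v := by
    intro u v huv
    have h1 := hL (v - u) fun y => by simpa using huv y
    rw [map_sub] at h1
    linarith
  let Λ₀ : C_c(Y, ℝ) →ₗ[ℝ] ℝ :=
    { toFun := fun f => L f.toBoundedContinuousFunction
      map_add' := fun f g => by
        rw [← map_add]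
        rfl
      map_smul' := fun r f => by
        rw [← map_smul]
        rfl }
  let Λ : C_c(Y, ℝ) →ₚ[ℝ] ℝ := PositiveLinearMap.mk₀ Λ₀ fun f hf => hL _ fun y => hf y
  let π := RealRMK.rieszMeasure Λ
  have hπ : ∀ f : C_c(Y, ℝ), ∫ y, f y ∂π = L f.toBoundedContinuousFunction :=
    fun f => RealRMK.integral_rieszMeasure Λ f
  have hfin : IsFiniteMeasure π := by
    constructor
    refine lt_of_le_of_lt ?_ (ENNReal.ofReal_lt_top (r := L 1))
    calc π univ = ∫⁻ y, liminf (fun k => ENNReal.ofReal (χ k y)) atTop ∂π := by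
          rw [← lintegral_one]
          refine lintegral_congr fun y => ?_
          have h1 := (ENNReal.continuous_ofReal.tendsto 1).comp (hχ y)
          simpa [Function.comp_def] using h1.liminf_eq.symm
      _ ≤ liminf (fun k => ∫⁻ y, ENNReal.ofReal (χ k y) ∂π) atTop :=
          lintegral_liminf_le fun k =>
            ENNReal.measurable_ofReal.comp (χ k).continuous.measurable
      _ ≤ ENNReal.ofReal (L 1) := by
          refine (liminf_le_liminf (v := fun _ => ENNReal.ofReal (L 1))
            (Eventually.of_forall fun k => ?_)).trans_eq (by simp)
          rw [← ofReal_integral_eq_lintegral_ofReal (f := fun y => χ k y)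
            ((χ k).continuous.integrable_of_hasCompactSupport (χ k).hasCompactSupport)
            (Eventually.of_forall (hχ0 k)), hπ]
          exact ENNReal.ofReal_le_ofReal (hmono _ _ fun y => hχ1 k y)
  refine ⟨π, hfin, fun u => ?_⟩
  let v : ℕ → C_c(Y, ℝ) := fun k => ⟨u.toContinuousMap * (χ k).toContinuousMap,
    (χ k).hasCompactSupport.mul_left⟩
  have hv : ∀ k y, v k y = u y * χ k y := fun k y => rfl
  have h1 : Tendsto (fun k => ∫ y, v k y ∂π) atTop (𝓝 (∫ y, u y ∂π)) := by
    refine tendsto_integral_of_dominated_convergence (fun _ => ‖u‖)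
      (fun k => (v k).continuous.aestronglyMeasurable) (integrable_const _) ?_ ?_
    · refine fun k => Eventually.of_forall fun y => ?_
      rw [hv, norm_mul]
      refine (mul_le_mul (u.norm_coe_le_norm y) ?_ (norm_nonneg _) (norm_nonneg _)).trans_eq
        (mul_one _)
      rw [Real.norm_of_nonneg (hχ0 k y)]
      exact hχ1 k y
    · refine Eventually.of_forall fun y => ?_
      simpa [hv] using (hχ y).const_mul (u y)
  have h2 : Tendsto (fun k => ∫ y, v k y ∂π) atTop (𝓝 (L u)) := by
    simp only [hπ]
    have h3 : Tendsto (fun k => ‖u‖ * (L 1 - L (χ k).toBoundedContinuousFunction)) atTop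
        (𝓝 0) := by
      simpa using (htight.const_sub (L 1)).const_mul ‖u‖
    rw [tendsto_iff_norm_sub_tendsto_zero]
    refine squeeze_zero (fun _ => norm_nonneg _) (fun k => ?_) h3
    rw [← map_sub, ← map_sub, ← smul_eq_mul, ← map_smul, Real.norm_eq_abs, abs_le, ← map_neg]
    have hb : ∀ y, |u y| * (1 - χ k y) ≤ ‖u‖ * (1 - χ k y) := fun y =>
      mul_le_mul_of_nonneg_right (u.norm_coe_le_norm y) (sub_nonneg.2 (hχ1 k y))
    constructor <;> refine hmono _ _ fun y => ?_
    · have h4 : -(‖u‖ * (1 - χ k y)) ≤ u y * χ k y - u y := by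
        nlinarith [hb y, le_abs_self (u y), sub_nonneg.2 (hχ1 k y)]
      exact h4
    · have h4 : u y * χ k y - u y ≤ ‖u‖ * (1 - χ k y) := by
        nlinarith [hb y, neg_abs_le (u y), sub_nonneg.2 (hχ1 k y)]
      exact h4
  exact tendsto_nhds_unique h1 h2

/-- A continuous cutoff function, equal to `1` on the ball of radius `k` and vanishing outside
the ball of radius `k + 1`. -/
noncomputable def normCutoff (Y : Type*) [NormedAddCommGroup Y] [ProperSpace Y] (k : ℕ) :
    C_c(Y, ℝ) where
  toFun y := max 0 (min 1 (k + 1 - ‖y‖))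
  continuous_toFun := by fun_prop
  hasCompactSupport' := by
    refine HasCompactSupport.intro (isCompact_closedBall (0 : Y) (k + 1)) fun y hy => ?_
    rw [mem_closedBall_zero_iff, not_le] at hy
    exact max_eq_left ((min_le_right _ _).trans (by linarith))

section normCutoff

variable {Y : Type*} [NormedAddCommGroup Y] [ProperSpace Y]

lemma normCutoff_apply (k : ℕ) (y : Y) :
    normCutoff Y k y = max 0 (min 1 (k + 1 - ‖y‖)) := rfl

lemma normCutoff_nonneg (k : ℕ) (y : Y) : 0 ≤ normCutoff Y k y := le_max_left _ _

lemma normCutoff_le_one (k : ℕ) (y : Y) : normCutoff Y k y ≤ 1 :=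
  max_le zero_le_one (min_le_left _ _)

lemma tendsto_normCutoff (y : Y) : Tendsto (fun k => normCutoff Y k y) atTop (𝓝 1) := by
  refine tendsto_const_nhds.congr' ?_
  filter_upwards [eventually_ge_atTop ⌈‖y‖⌉₊] with k hk
  have h1 : ‖y‖ ≤ k := (Nat.le_ceil _).trans (by exact_mod_cast hk)
  rw [normCutoff_apply, min_eq_left (by linarith), max_eq_right zero_le_one]

lemma one_sub_normCutoff_prod_le (k : ℕ) (p : Y × Y) :
    1 - normCutoff (Y × Y) k p ≤ (1 - normCutoff Y k p.1) + (1 - normCutoff Y k p.2) := by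
  have h1 := normCutoff_le_one k p.1
  have h2 := normCutoff_le_one k p.2
  rcases max_choice ‖p.1‖ ‖p.2‖ with h | h <;>
    simp only [normCutoff_apply, Prod.norm_def, h] at * <;> linarith

lemma tendsto_integral_normCutoff [MeasurableSpace Y] [BorelSpace Y] (ν : Measure Y)
    [IsProbabilityMeasure ν] : Tendsto (fun k => ∫ y, normCutoff Y k y ∂ν) atTop (𝓝 1) := by
  have h1 : Tendsto (fun k => ∫ y, normCutoff Y k y ∂ν) atTop (𝓝 (∫ _, (1 : ℝ) ∂ν)) := by
    refine tendsto_integral_of_dominated_convergence (fun _ => 1)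
      (fun k => (normCutoff Y k).continuous.aestronglyMeasurable) (integrable_const _) ?_
      (Eventually.of_forall tendsto_normCutoff)
    refine fun k => Eventually.of_forall fun y => ?_
    rw [Real.norm_of_nonneg (normCutoff_nonneg k y)]
    exact normCutoff_le_one k y
  simpa using h1

end normCutoff

variable {X : Type*} [NormedAddCommGroup X] [MeasurableSpace X] [BorelSpace X]

/-- Hahn–Banach step in the proof of Kantorovich duality: if every pair of admissible potentials
has value at most `D`, there is a positive functional on `C_b(X × X)` with marginals `ν₁`, `ν₂`
and cost at most `D`. -/
lemma exists_linearMap_of_dual_le (ν₁ ν₂ : Measure X) [IsProbabilityMeasure ν₁]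
    [IsProbabilityMeasure ν₂] (c : X → X → ℝ≥0∞) (D : ℝ)
    (hD : ∀ φ ψ : X →ᵇ ℝ, (∀ x y, ENNReal.ofReal (φ x + ψ y) ≤ c x y) →
      ∫ x, φ x ∂ν₁ + ∫ y, ψ y ∂ν₂ ≤ D) :
    ∃ L : (X × X →ᵇ ℝ) →ₗ[ℝ] ℝ, (∀ u : X × X →ᵇ ℝ, (∀ p, 0 ≤ u p) → 0 ≤ L u) ∧
      (∀ φ : X →ᵇ ℝ, L (φ.compContinuous ⟨Prod.fst, continuous_fst⟩) = ∫ x, φ x ∂ν₁) ∧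
      (∀ ψ : X →ᵇ ℝ, L (ψ.compContinuous ⟨Prod.snd, continuous_snd⟩) = ∫ y, ψ y ∂ν₂) ∧
      ∀ u : X × X →ᵇ ℝ, (∀ x y, ENNReal.ofReal (u (x, y)) ≤ c x y) → L u ≤ D := by
  let E := (X →ᵇ ℝ) × (X →ᵇ ℝ) × ℝ × (X × X →ᵇ ℝ)
  let F : E →ₗ[ℝ] ℝ :=
    { toFun := fun e => ∫ x, e.1 x ∂ν₁ + ∫ y, e.2.1 y ∂ν₂ + e.2.2.1 * D
      map_add' := fun e e' => by
        show ∫ x, (e.1 x + e'.1 x) ∂ν₁ + ∫ y, (e.2.1 y + e'.2.1 y) ∂ν₂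
          + (e.2.2.1 + e'.2.2.1) * D = _
        rw [integral_add (e.1.integrable _) (e'.1.integrable _),
          integral_add (e.2.1.integrable _) (e'.2.1.integrable _)]
        ring
      map_smul' := fun r e => by
        show ∫ x, r * e.1 x ∂ν₁ + ∫ y, r * e.2.1 y ∂ν₂ + r * e.2.2.1 * D
          = r * (∫ x, e.1 x ∂ν₁ + ∫ y, e.2.1 y ∂ν₂ + e.2.2.1 * D)
        rw [integral_const_mul, integral_const_mul]
        ring }
  let p : Submodule ℝ E :=
    { carrier := {e | e.2.2.2 = 0}
      add_mem' := fun {a b} ha hb => by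
        have ha' : a.2.2.2 = 0 := ha
        have hb' : b.2.2.2 = 0 := hb
        show a.2.2.2 + b.2.2.2 = 0
        rw [ha', hb', add_zero]
      zero_mem' := rfl
      smul_mem' := fun r a ha => by
        have ha' : a.2.2.2 = 0 := ha
        show r • a.2.2.2 = 0
        rw [ha', smul_zero] }
  let s : PointedCone ℝ E :=
    { carrier := {e | 0 ≤ e.2.2.1 ∧ ∀ x y, ENNReal.ofReal (-(e.1 x + e.2.1 y + e.2.2.2 (x, y))) ≤
        ENNReal.ofReal e.2.2.1 * c x y}
      add_mem' := fun {a b} ha hb => by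
        refine ⟨add_nonneg ha.1 hb.1, fun x y => ?_⟩
        have h1 := ENNReal.ofReal_add_le.trans (add_le_add (ha.2 x y) (hb.2 x y))
        rw [← add_mul, ← ENNReal.ofReal_add ha.1 hb.1] at h1
        refine le_trans (le_of_eq ?_) h1
        congr 1
        show -(a.1 x + b.1 x + (a.2.1 y + b.2.1 y) + (a.2.2.2 (x, y) + b.2.2.2 (x, y))) = _
        ring
      zero_mem' := ⟨le_rfl, fun x y => by simp⟩
      smul_mem' := fun r a ha => by
        refine ⟨mul_nonneg r.2 ha.1, fun x y => ?_⟩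
        have h1 := mul_le_mul_right (ha.2 x y) (ENNReal.ofReal r)
        rw [← mul_assoc, ← ENNReal.ofReal_mul r.2, ← ENNReal.ofReal_mul r.2] at h1
        refine le_trans (le_of_eq ?_) h1
        congr 1
        show -(r.1 * a.1 x + r.1 * a.2.1 y + r.1 * a.2.2.2 (x, y)) = _
        ring }
  have hs : ∀ e : E, e ∈ s ↔ 0 ≤ e.2.2.1 ∧ ∀ x y,
      ENNReal.ofReal (-(e.1 x + e.2.1 y + e.2.2.2 (x, y))) ≤ ENNReal.ofReal e.2.2.1 * c x y :=
    fun e => Iff.rfl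
  have hnonneg : ∀ e : (⟨p, F.domRestrict p⟩ : E →ₗ.[ℝ] ℝ).domain, (e : E) ∈ s →
      0 ≤ (⟨p, F.domRestrict p⟩ : E →ₗ.[ℝ] ℝ) e := by
    rintro ⟨⟨φ, ψ, l, u⟩, hu⟩ h
    obtain rfl : u = 0 := hu
    obtain ⟨hl, hc⟩ := (hs _).1 h
    show 0 ≤ ∫ x, φ x ∂ν₁ + ∫ y, ψ y ∂ν₂ + l * D
    have key : ∀ ε : ℝ, 0 < ε → 0 ≤ ∫ x, φ x ∂ν₁ + ∫ y, ψ y ∂ν₂ + (l + ε) * D := by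
      intro ε hε
      have hlε : 0 < l + ε := by linarith
      have h1 := hD ((-(l + ε)⁻¹) • φ) ((-(l + ε)⁻¹) • ψ) fun x y => by
        have h2 : ENNReal.ofReal (-(φ x + ψ y)) ≤ ENNReal.ofReal (l + ε) * c x y := by
          refine le_trans ?_ (mul_le_mul_left (ENNReal.ofReal_le_ofReal (by linarith :
            l ≤ l + ε)) _)
          simpa using hc x y
        have h3 := mul_le_mul_right h2 (ENNReal.ofReal (l + ε)⁻¹)
        rw [← mul_assoc, ← ENNReal.ofReal_mul (inv_pos.2 hlε).le,
          ← ENNReal.ofReal_mul (inv_pos.2 hlε).le, inv_mul_cancel₀ hlε.ne', ENNReal.ofReal_one,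
          one_mul] at h3
        refine le_trans (le_of_eq ?_) h3
        congr 1
        simp
        ring
      simp only [BoundedContinuousFunction.coe_smul, smul_eq_mul, integral_const_mul] at h1
      have h2 := mul_le_mul_of_nonneg_left h1 hlε.le
      rw [mul_add, ← mul_assoc, ← mul_assoc, mul_neg, mul_inv_cancel₀ hlε.ne'] at h2
      linarith
    have h1 : Tendsto (fun ε : ℝ => ∫ x, φ x ∂ν₁ + ∫ y, ψ y ∂ν₂ + (l + ε) * D) (𝓝[>] 0)
        (𝓝 (∫ x, φ x ∂ν₁ + ∫ y, ψ y ∂ν₂ + (l + 0) * D)) :=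
      tendsto_nhdsWithin_of_tendsto_nhds (Continuous.tendsto (by fun_prop) 0)
    rw [add_zero] at h1
    exact ge_of_tendsto h1 (eventually_mem_nhdsWithin.mono key)
  have hdense : ∀ e : E, ∃ e' : (⟨p, F.domRestrict p⟩ : E →ₗ.[ℝ] ℝ).domain, (e' : E) + e ∈ s := by
    rintro ⟨φ, ψ, l, u⟩
    refine ⟨⟨(-φ + BoundedContinuousFunction.const X ‖u‖, -ψ, -l, 0), rfl⟩, (hs _).2 ⟨?_, ?_⟩⟩
    · exact (neg_add_cancel l).ge
    · intro x y
      have h1 : -(-φ x + ‖u‖ + φ x + (-ψ y + ψ y) + (0 + u (x, y))) ≤ 0 := by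
        linarith [neg_abs_le (u (x, y)), u.norm_coe_le_norm (x, y), Real.norm_eq_abs (u (x, y))]
      exact (ENNReal.ofReal_of_nonpos h1).trans_le zero_le
  obtain ⟨g, hgF, hgs⟩ := riesz_extension s ⟨p, F.domRestrict p⟩ hnonneg hdense
  have hg : ∀ φ ψ l, g ((φ, ψ, l, 0) : E) = ∫ x, φ x ∂ν₁ + ∫ y, ψ y ∂ν₂ + l * D :=
    fun φ ψ l => hgF ⟨(φ, ψ, l, 0), rfl⟩
  let ι : (X × X →ᵇ ℝ) →ₗ[ℝ] E :=
    LinearMap.inr ℝ _ _ ∘ₗ LinearMap.inr ℝ _ _ ∘ₗ LinearMap.inr ℝ _ _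
  have hι : ∀ u, ι u = (0, 0, 0, u) := fun u => rfl
  have hsplit : ∀ φ ψ l u, g ((φ, ψ, l, u) : E)
      = ∫ x, φ x ∂ν₁ + ∫ y, ψ y ∂ν₂ + l * D + g (ι u) := by
    intro φ ψ l u
    rw [← hg, ← map_add, hι]
    congr 1
    show (φ, ψ, l, u) = (φ + 0, ψ + 0, l + 0, 0 + u)
    simp only [add_zero, zero_add]
  refine ⟨g ∘ₗ ι, fun u hu => ?_, fun φ => ?_, fun ψ => ?_, fun u hu => ?_⟩
  · refine hgs _ ((hs _).2 ⟨le_rfl, fun x y => ?_⟩)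
    simpa [hι] using hu (x, y)
  · have h1 := hgs (φ, 0, 0, -φ.compContinuous ⟨Prod.fst, continuous_fst⟩)
      ((hs _).2 ⟨le_rfl, fun x y => by simp⟩)
    have h2 := hgs (-φ, 0, 0, φ.compContinuous ⟨Prod.fst, continuous_fst⟩)
      ((hs _).2 ⟨le_rfl, fun x y => by simp⟩)
    rw [hsplit] at h1 h2
    simp [integral_neg] at h1 h2
    simp only [LinearMap.comp_apply]
    linarith
  · have h1 := hgs (0, ψ, 0, -ψ.compContinuous ⟨Prod.snd, continuous_snd⟩)
      ((hs _).2 ⟨le_rfl, fun x y => by simp⟩)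
    have h2 := hgs (0, -ψ, 0, ψ.compContinuous ⟨Prod.snd, continuous_snd⟩)
      ((hs _).2 ⟨le_rfl, fun x y => by simp⟩)
    rw [hsplit] at h1 h2
    simp [integral_neg] at h1 h2
    simp only [LinearMap.comp_apply]
    linarith
  · have h1 := hgs (0, 0, 1, -u) ((hs _).2 ⟨zero_le_one, fun x y => by simpa using hu x y⟩)
    rw [hsplit] at h1
    simp at h1
    simpa using h1

/-- **Kantorovich duality** (the hard inequality): if every pair of admissible potentials has value
at most `D`, there is a coupling for which every bounded continuous function below the cost has
integral at most `D`. -/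
theorem exists_coupling_integral_le [ProperSpace X] (ν₁ ν₂ : Measure X) [IsProbabilityMeasure ν₁]
    [IsProbabilityMeasure ν₂] (c : X → X → ℝ≥0∞) (D : ℝ)
    (hD : ∀ φ ψ : X →ᵇ ℝ, (∀ x y, ENNReal.ofReal (φ x + ψ y) ≤ c x y) →
      ∫ x, φ x ∂ν₁ + ∫ y, ψ y ∂ν₂ ≤ D) :
    ∃ π ∈ Coupling ν₁ ν₂, IsFiniteMeasure π ∧
      ∀ u : X × X →ᵇ ℝ, (∀ x y, ENNReal.ofReal (u (x, y)) ≤ c x y) → ∫ p, u p ∂π ≤ D := by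
  obtain ⟨L, hL, hL1, hL2, hLD⟩ := exists_linearMap_of_dual_le ν₁ ν₂ c D hD
  have hL_one : L 1 = 1 := by
    have h1 := hL1 1
    simpa using h1
  have htight : Tendsto (fun k => L (normCutoff (X × X) k).toBoundedContinuousFunction) atTop
      (𝓝 (L 1)) := by
    let χ : ℕ → X →ᵇ ℝ := fun k => (normCutoff X k).toBoundedContinuousFunction
    have h1 : Tendsto (fun k => 1 - ((1 - ∫ x, normCutoff X k x ∂ν₁)
        + (1 - ∫ x, normCutoff X k x ∂ν₂))) atTop (𝓝 (1 - ((1 - 1) + (1 - 1)))) :=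
      (((tendsto_integral_normCutoff ν₁).const_sub 1).add
        ((tendsto_integral_normCutoff ν₂).const_sub 1)).const_sub 1
    rw [hL_one]
    refine tendsto_of_tendsto_of_tendsto_of_le_of_le (by simpa using h1) tendsto_const_nhds
      (fun k => ?_) fun k => ?_
    · have h2 := hL ((normCutoff (X × X) k).toBoundedContinuousFunction
        - (1 - ((1 - (χ k).compContinuous ⟨Prod.fst, continuous_fst⟩)
          + (1 - (χ k).compContinuous ⟨Prod.snd, continuous_snd⟩)))) fun p => by
        have h3 := one_sub_normCutoff_prod_le k p
        have h4 : 0 ≤ normCutoff (X × X) k p - (1 - ((1 - normCutoff X k p.1)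
          + (1 - normCutoff X k p.2))) := by linarith
        exact h4
      rw [map_sub, map_sub, map_add, map_sub, map_sub, hL1, hL2, hL_one] at h2
      exact sub_nonneg.1 h2
    · have h2 := hL (1 - (normCutoff (X × X) k).toBoundedContinuousFunction) fun p =>
        sub_nonneg.2 (normCutoff_le_one k p)
      rw [map_sub, hL_one] at h2
      exact sub_nonneg.1 h2
  obtain ⟨π, hπ, hπL⟩ := exists_measure_integral_eq L hL (normCutoff (X × X))
    normCutoff_nonneg normCutoff_le_one tendsto_normCutoff htight
  refine ⟨π, ⟨?_, ?_⟩, hπ, fun u hu => (hπL u).trans_le (hLD u hu)⟩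
  · refine ext_of_forall_integral_eq_of_IsFiniteMeasure fun φ => ?_
    rw [integral_map (by fun_prop) φ.continuous.aestronglyMeasurable, ← hL1, ← hπL]
    rfl
  · refine ext_of_forall_integral_eq_of_IsFiniteMeasure fun φ => ?_
    rw [integral_map (by fun_prop) φ.continuous.aestronglyMeasurable, ← hL2, ← hπL]
    rfl

end Duality

section TransportEntropy

open scoped BoundedContinuousFunction

/-- The easy half of the Donsker–Varadhan variational formula. -/
lemma integral_le_integral_llr_add_log {X : Type*} [MeasurableSpace X] {μ ν : Measure X}
    [IsProbabilityMeasure μ] [IsProbabilityMeasure ν] (hνμ : ν ≪ μ)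
    (h_int : Integrable (llr ν μ) ν) {f : X → ℝ} (hf : Integrable f ν)
    (hexp : Integrable (fun x => Real.exp (f x)) μ) :
    ∫ x, f x ∂ν ≤ ∫ x, llr ν μ x ∂ν + Real.log (∫ x, Real.exp (f x) ∂μ) := by
  have := isProbabilityMeasure_tilted hexp
  have h1 := InformationTheory.integral_llr_add_sub_measure_univ_nonneg
    (hνμ.trans (absolutelyContinuous_tilted hexp)) (integrable_llr_tilted_right hνμ hf h_int hexp)
  rw [integral_llr_tilted_right hνμ hf hexp h_int, probReal_univ, probReal_univ] at h1
  linarith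

variable {ρ : ℝ → ℝ}

lemma mul_le_sq_of_convexOn_neg_log_exp (hρpos : ∀ t : ℝ, 0 ≤ t → 0 < ρ t)
    (hρanti : AntitoneOn ρ (Ici 0))
    (hρconv : ConvexOn ℝ univ (fun t : ℝ => -Real.log (ρ (Real.exp t)))) {a b r : ℝ}
    (ha : 0 ≤ a) (hb : 0 ≤ b) (hr : 0 ≤ r) (hrab : r ≤ a * b) :
    ρ (a ^ 2) * ρ (b ^ 2) ≤ ρ r ^ 2 := by
  have hpa := hρpos _ (sq_nonneg a)
  have hpb := hρpos _ (sq_nonneg b)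
  rcases (mul_nonneg ha hb).eq_or_lt with hab | hab
  · have hr0 : r = 0 := le_antisymm (hrab.trans_eq hab.symm) hr
    rw [hr0, sq (ρ 0)]
    exact mul_le_mul (hρanti self_mem_Ici (mem_Ici.2 (sq_nonneg a)) (sq_nonneg a))
      (hρanti self_mem_Ici (mem_Ici.2 (sq_nonneg b)) (sq_nonneg b)) hpb.le (hρpos 0 le_rfl).le
  · have ha' : 0 < a := lt_of_le_of_ne ha (by rintro rfl; simp at hab)
    have hb' : 0 < b := lt_of_le_of_ne hb (by rintro rfl; simp at hab)
    have h1 := hρconv.2 (mem_univ (2 * Real.log a)) (mem_univ (2 * Real.log b))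
      (by norm_num : (0 : ℝ) ≤ 1 / 2) (by norm_num : (0 : ℝ) ≤ 1 / 2) (by norm_num)
    have e1 : Real.exp (2 * Real.log a) = a ^ 2 := by
      rw [two_mul, Real.exp_add, Real.exp_log ha', sq]
    have e2 : Real.exp (2 * Real.log b) = b ^ 2 := by
      rw [two_mul, Real.exp_add, Real.exp_log hb', sq]
    have e3 : Real.exp ((1 / 2 : ℝ) • (2 * Real.log a) + (1 / 2 : ℝ) • (2 * Real.log b))
        = a * b := by
      rw [smul_eq_mul, smul_eq_mul, ← mul_assoc, ← mul_assoc]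
      norm_num
      rw [Real.exp_add, Real.exp_log ha', Real.exp_log hb']
    simp only [e1, e2, e3] at h1
    simp only [smul_eq_mul] at h1
    have h2 : ρ (a ^ 2) * ρ (b ^ 2) ≤ ρ (a * b) ^ 2 := by
      rw [← Real.log_le_log_iff (mul_pos hpa hpb) (pow_pos (hρpos _ hab.le) 2),
        Real.log_mul hpa.ne' hpb.ne', Real.log_pow]
      push_cast
      linarith
    exact h2.trans (pow_le_pow_left₀ (hρpos _ hab.le).le
      (hρanti (mem_Ici.2 hr) (mem_Ici.2 hab.le) hrab) 2)

variable {n : ℕ}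

lemma integral_radial_pos (hρpos : ∀ t : ℝ, 0 ≤ t → 0 < ρ t)
    (hρint : Integrable (fun x : EuclideanSpace ℝ (Fin n) => ρ (‖x‖ ^ 2))) :
    0 < ∫ x : EuclideanSpace ℝ (Fin n), ρ (‖x‖ ^ 2) := by
  rw [integral_pos_iff_support_of_nonneg (fun x => (hρpos _ (sq_nonneg ‖x‖)).le) hρint]
  have h1 : Function.support (fun x : EuclideanSpace ℝ (Fin n) => ρ (‖x‖ ^ 2)) = univ :=
    eq_univ_of_forall fun x => (hρpos _ (sq_nonneg ‖x‖)).ne'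
  rw [h1]
  exact Measure.measure_univ_pos.2 (NeZero.ne _)

lemma isProbabilityMeasure_radial (hρpos : ∀ t : ℝ, 0 ≤ t → 0 < ρ t)
    (hρint : Integrable (fun x : EuclideanSpace ℝ (Fin n) => ρ (‖x‖ ^ 2))) :
    IsProbabilityMeasure ((volume : Measure (EuclideanSpace ℝ (Fin n))).withDensity fun x =>
      ENNReal.ofReal (ρ (‖x‖ ^ 2) / ∫ y : EuclideanSpace ℝ (Fin n), ρ (‖y‖ ^ 2))) := by
  have hZ := integral_radial_pos hρpos hρint
  constructor
  rw [withDensity_apply _ MeasurableSet.univ, setLIntegral_univ,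
    ← ofReal_integral_eq_lintegral_ofReal (hρint.div_const _)
    (Eventually.of_forall fun x => div_nonneg (hρpos _ (sq_nonneg ‖x‖)).le hZ.le),
    integral_div, div_self hZ.ne', ENNReal.ofReal_one]

/-- Dual form of the transport-entropy inequality. -/
lemma lintegral_exp_mul_lintegral_exp_le_one (hρpos : ∀ t : ℝ, 0 ≤ t → 0 < ρ t)
    (hρanti : AntitoneOn ρ (Ici 0))
    (hρint : Integrable (fun x : EuclideanSpace ℝ (Fin n) => ρ (‖x‖ ^ 2)))
    {μ : Measure (EuclideanSpace ℝ (Fin n))} (hμ : μ = volume.withDensity (fun x =>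
      ENNReal.ofReal (ρ (‖x‖ ^ 2) / ∫ y : EuclideanSpace ℝ (Fin n), ρ (‖y‖ ^ 2))))
    {φ ψ : EuclideanSpace ℝ (Fin n) → ℝ} (hφ : Measurable φ) (hψ : Measurable ψ)
    (hφe : ∀ x, φ (-x) = φ x) (hψe : ∀ x, ψ (-x) = ψ x)
    (h : ∀ x y, 0 ≤ ⟪x, y⟫ →
      φ x + ψ y ≤ Real.log (ρ ⟪x, y⟫ ^ 2 / (ρ (‖x‖ ^ 2) * ρ (‖y‖ ^ 2)))) :
    (∫⁻ x, ENNReal.ofReal (Real.exp (φ x)) ∂μ) * ∫⁻ x, ENNReal.ofReal (Real.exp (ψ x)) ∂μ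
      ≤ 1 := by
  have hZ := integral_radial_pos hρpos hρint
  set Z := ∫ y : EuclideanSpace ℝ (Fin n), ρ (‖y‖ ^ 2) with hZdef
  have hpos : ∀ x : EuclideanSpace ℝ (Fin n), 0 < ρ (‖x‖ ^ 2) := fun x => hρpos _ (sq_nonneg _)
  have hρm : Measurable fun x : EuclideanSpace ℝ (Fin n) => ρ (‖x‖ ^ 2) := by
    have h1 : Antitone fun u => ρ (max u 0) := fun u v huv =>
      hρanti (mem_Ici.2 (le_max_right _ _)) (mem_Ici.2 (le_max_right _ _))
        (max_le_max_right 0 huv)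
    have h2 : Measurable fun x : EuclideanSpace ℝ (Fin n) => ρ (max (‖x‖ ^ 2) 0) :=
      h1.measurable.comp (by fun_prop)
    simpa [sq_nonneg] using h2
  have hI : ∫⁻ x : EuclideanSpace ℝ (Fin n), ENNReal.ofReal (ρ (‖x‖ ^ 2)) = ENNReal.ofReal Z :=
    (ofReal_integral_eq_lintegral_ofReal hρint (Eventually.of_forall fun x => (hpos x).le)).symm
  have hint : ∀ {θ : EuclideanSpace ℝ (Fin n) → ℝ}, Measurable θ →
      ∫⁻ x, ENNReal.ofReal (Real.exp (θ x)) ∂μ = (ENNReal.ofReal Z)⁻¹ *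
        ∫⁻ x, ENNReal.ofReal (Real.exp (θ x) * ρ (‖x‖ ^ 2)) := by
    intro θ hθ
    have hm : Measurable fun x => ENNReal.ofReal (Real.exp (θ x) * ρ (‖x‖ ^ 2)) :=
      (hθ.exp.mul hρm).ennreal_ofReal
    rw [hμ, lintegral_withDensity_eq_lintegral_mul _ (hρm.div_const _).ennreal_ofReal
      hθ.exp.ennreal_ofReal, ← lintegral_const_mul _ hm]
    refine lintegral_congr fun x => ?_
    rw [Pi.mul_apply, ENNReal.ofReal_div_of_pos hZ, ENNReal.ofReal_mul (Real.exp_pos _).le,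
      div_eq_mul_inv]
    ring
  have hBS := functional_blaschkeSantalo hρpos hρanti (f := fun x => Real.exp (φ x) * ρ (‖x‖ ^ 2))
    (g := fun x => Real.exp (ψ x) * ρ (‖x‖ ^ 2)) (hφ.exp.mul hρm) (hψ.exp.mul hρm)
    (fun x => mul_nonneg (Real.exp_pos _).le (hpos x).le)
    (fun x => mul_nonneg (Real.exp_pos _).le (hpos x).le)
    (fun x => by simp only [hφe, norm_neg]) (fun x => by simp only [hψe, norm_neg])
    fun x y hxy => by
      have h1 := Real.exp_le_exp.2 (h x y hxy)
      rw [Real.exp_log (div_pos (pow_pos (hρpos _ hxy) 2) (mul_pos (hpos x) (hpos y))),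
        le_div_iff₀ (mul_pos (hpos x) (hpos y)), Real.exp_add] at h1
      linarith
  rw [hI] at hBS
  rw [hint hφ, hint hψ, mul_mul_mul_comm, ← sq]
  refine (mul_le_mul_right hBS _).trans_eq ?_
  rw [← mul_pow, ENNReal.inv_mul_cancel (by simpa using hZ) ENNReal.ofReal_ne_top, one_pow]

/-- Kantorovich potentials for the cost of the theorem satisfy the dual inequality. -/
lemma integral_add_integral_le_of_admissible (hρpos : ∀ t : ℝ, 0 ≤ t → 0 < ρ t)
    (hρanti : AntitoneOn ρ (Ici 0))
    (hρint : Integrable (fun x : EuclideanSpace ℝ (Fin n) => ρ (‖x‖ ^ 2)))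
    {μ : Measure (EuclideanSpace ℝ (Fin n))} (hμ : μ = volume.withDensity (fun x =>
      ENNReal.ofReal (ρ (‖x‖ ^ 2) / ∫ y : EuclideanSpace ℝ (Fin n), ρ (‖y‖ ^ 2))))
    {ν₁ ν₂ : Measure (EuclideanSpace ℝ (Fin n))}
    [IsProbabilityMeasure ν₁] [IsProbabilityMeasure ν₂]
    (hν₁sym : ν₁.map (fun x => -x) = ν₁) (hν₂sym : ν₂.map (fun x => -x) = ν₂)
    (h₁ : ν₁ ≪ μ) (h₁i : Integrable (llr ν₁ μ) ν₁) (h₂ : ν₂ ≪ μ)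
    (h₂i : Integrable (llr ν₂ μ) ν₂) (φ ψ : EuclideanSpace ℝ (Fin n) →ᵇ ℝ)
    (h : ∀ x y, 0 ≤ ⟪x, y⟫ →
      φ x + ψ y ≤ Real.log (ρ ⟪x, y⟫ ^ 2 / (ρ (‖x‖ ^ 2) * ρ (‖y‖ ^ 2)))) :
    ∫ x, φ x ∂ν₁ + ∫ y, ψ y ∂ν₂ ≤ ∫ x, llr ν₁ μ x ∂ν₁ + ∫ x, llr ν₂ μ x ∂ν₂ := by
  have hμp : IsProbabilityMeasure μ := hμ ▸ isProbabilityMeasure_radial hρpos hρint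
  let e : (EuclideanSpace ℝ (Fin n) →ᵇ ℝ) → EuclideanSpace ℝ (Fin n) →ᵇ ℝ := fun θ =>
    (1 / 2 : ℝ) • (θ + θ.compContinuous ⟨fun x => -x, continuous_neg⟩)
  have he : ∀ θ x, e θ x = 1 / 2 * (θ x + θ (-x)) := fun θ x => rfl
  have heven : ∀ θ x, e θ (-x) = e θ x := fun θ x => by rw [he, he, neg_neg, add_comm]
  have hsym : ∀ (ν : Measure (EuclideanSpace ℝ (Fin n))) [IsProbabilityMeasure ν],
      ν.map (fun x => -x) = ν → ∀ θ : EuclideanSpace ℝ (Fin n) →ᵇ ℝ,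
      ∫ x, e θ x ∂ν = ∫ x, θ x ∂ν := by
    intro ν _ hν θ
    have h1 : ∫ x, θ (-x) ∂ν = ∫ x, θ x ∂ν := by
      conv_rhs => rw [← hν]
      rw [integral_map (by fun_prop) θ.continuous.aestronglyMeasurable]
    have h2 : Integrable (fun x => θ (-x)) ν :=
      (θ.compContinuous ⟨fun x => -x, continuous_neg⟩).integrable ν
    simp only [he]
    rw [integral_const_mul, integral_add (θ.integrable ν) h2, h1]
    ring
  have hexp : ∀ θ : EuclideanSpace ℝ (Fin n) →ᵇ ℝ, Integrable (fun x => Real.exp (θ x)) μ := by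
    intro θ
    refine Integrable.of_bound (Real.continuous_exp.comp θ.continuous).aestronglyMeasurable
      (Real.exp ‖θ‖) (Eventually.of_forall fun x => ?_)
    rw [Real.norm_of_nonneg (Real.exp_pos _).le]
    exact Real.exp_le_exp.2 ((le_abs_self _).trans (θ.norm_coe_le_norm x))
  have key := lintegral_exp_mul_lintegral_exp_le_one hρpos hρanti hρint hμ
    (φ := e φ) (ψ := e ψ) (e φ).continuous.measurable (e ψ).continuous.measurable
    (heven φ) (heven ψ) fun x y hxy => by
      have h1 := h x y hxy
      have h2 := h (-x) (-y) (by rwa [inner_neg_neg])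
      rw [inner_neg_neg, norm_neg, norm_neg] at h2
      rw [he, he]
      linarith
  rw [← ofReal_integral_eq_lintegral_ofReal (hexp _) (Eventually.of_forall fun x =>
      (Real.exp_pos _).le), ← ofReal_integral_eq_lintegral_ofReal (hexp _)
      (Eventually.of_forall fun x => (Real.exp_pos _).le),
    ← ENNReal.ofReal_mul (integral_exp_pos (hexp _)).le, ENNReal.ofReal_le_one] at key
  have hlog := Real.log_nonpos
    (mul_pos (integral_exp_pos (hexp (e φ))) (integral_exp_pos (hexp (e ψ)))).le key
  rw [Real.log_mul (integral_exp_pos (hexp _)).ne' (integral_exp_pos (hexp _)).ne'] at hlog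
  have d1 := integral_le_integral_llr_add_log h₁ h₁i ((e φ).integrable ν₁) (hexp _)
  have d2 := integral_le_integral_llr_add_log h₂ h₂i ((e ψ).integrable ν₂) (hexp _)
  rw [hsym ν₁ hν₁sym] at d1
  rw [hsym ν₂ hν₂sym] at d2
  linarith

/-- A cost which is a nonnegative continuous function `w` where `q ≥ 0` and `+∞` elsewhere has
integral at most `D` as soon as all bounded continuous functions below it do. -/
lemma lintegral_le_of_forall_boundedContinuous_le {Y : Type*} [TopologicalSpace Y]
    [MeasurableSpace Y] [BorelSpace Y] {π : Measure Y} [IsFiniteMeasure π] {w q : Y → ℝ}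
    (hw : Continuous w) (hq : Continuous q) (hw0 : ∀ y, 0 ≤ w y) {D : ℝ}
    (hD : ∀ u : Y →ᵇ ℝ, (∀ y, ENNReal.ofReal (u y) ≤ if 0 ≤ q y then ENNReal.ofReal (w y) else ⊤) →
      ∫ y, u y ∂π ≤ D) :
    ∫⁻ y, (if 0 ≤ q y then ENNReal.ofReal (w y) else ⊤) ∂π ≤ ENNReal.ofReal D := by
  have hk0 : ∀ (k : ℕ) y, 0 ≤ min (w y + k * max (-q y) 0) k := fun k y =>
    le_min (add_nonneg (hw0 y) (mul_nonneg k.cast_nonneg (le_max_right _ _))) k.cast_nonneg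
  let u : ℕ → Y →ᵇ ℝ := fun k => BoundedContinuousFunction.ofNormedAddCommGroup
    (fun y => min (w y + k * max (-q y) 0) k) (by fun_prop) k fun y => by
      rw [Real.norm_of_nonneg (hk0 k y)]
      exact min_le_right _ _
  have hu : ∀ k y, u k y = min (w y + k * max (-q y) 0) k := fun k y => rfl
  have hlim : ∀ y, (if 0 ≤ q y then ENNReal.ofReal (w y) else ⊤)
      ≤ liminf (fun k => ENNReal.ofReal (u k y)) atTop := by
    intro y
    refine (Tendsto.liminf_eq ?_).ge
    split_ifs with hy
    · refine tendsto_const_nhds.congr' ?_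
      filter_upwards [eventually_ge_atTop ⌈w y⌉₊] with k hk
      have h1 : w y ≤ k := (Nat.le_ceil _).trans (by exact_mod_cast hk)
      rw [hu, max_eq_right (by linarith), mul_zero, add_zero, min_eq_left h1]
    · refine ENNReal.tendsto_ofReal_atTop.comp ?_
      rw [not_le] at hy
      have h1 : Tendsto (fun k : ℕ => min 1 (-q y) * (k : ℝ)) atTop atTop :=
        tendsto_natCast_atTop_atTop.const_mul_atTop (lt_min one_pos (neg_pos.2 hy))
      refine tendsto_atTop_mono (fun k => ?_) h1
      have hk : (0 : ℝ) ≤ k := k.cast_nonneg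
      rw [hu, max_eq_left (by linarith)]
      refine le_min ?_ ?_
      · nlinarith [hw0 y, min_le_right 1 (-q y)]
      · nlinarith [min_le_left 1 (-q y)]
  calc ∫⁻ y, (if 0 ≤ q y then ENNReal.ofReal (w y) else ⊤) ∂π
      ≤ ∫⁻ y, liminf (fun k => ENNReal.ofReal (u k y)) atTop ∂π := lintegral_mono hlim
    _ ≤ liminf (fun k => ∫⁻ y, ENNReal.ofReal (u k y) ∂π) atTop :=
        lintegral_liminf_le fun k => ENNReal.measurable_ofReal.comp (u k).continuous.measurable
    _ ≤ ENNReal.ofReal D := by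
        refine (liminf_le_liminf (v := fun _ => ENNReal.ofReal D)
          (Eventually.of_forall fun k => ?_)).trans_eq (by simp)
        rw [← ofReal_integral_eq_lintegral_ofReal ((u k).integrable π)
          (Eventually.of_forall (hk0 k))]
        refine ENNReal.ofReal_le_ofReal (hD _ fun y => ?_)
        split_ifs with hy
        · refine ENNReal.ofReal_le_ofReal ?_
          rw [hu, max_eq_right (by linarith), mul_zero, add_zero]
          exact min_le_left _ _
        · exact le_top

end TransportEntropy

/-- Symmetrized transport-entropy inequality for rotationally invariant measures, with the
cost `ω_ρ(x,y) = log (ρ(x·y)² / (ρ(|x|²)ρ(|y|²)))` if `x·y ≥ 0` and `+∞` otherwise: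
if `ρ : [0,∞) → (0,∞)` is continuous, nonincreasing, with `x ↦ ρ(|x|²)` integrable and
`t ↦ −log ρ(eᵗ)` convex, and `μ_ρ` is the probability measure with density proportional to
`ρ(|x|²)`, then for all symmetric probability measures `ν₁, ν₂`,
`T_{ω_ρ}(ν₁,ν₂) ≤ H(ν₁|μ_ρ) + H(ν₂|μ_ρ)`. -/
theorem transport_entropy_symmetric (n : ℕ) (ρ : ℝ → ℝ)
    (hρpos : ∀ t : ℝ, 0 ≤ t → 0 < ρ t)
    (hρcont : ContinuousOn ρ (Set.Ici 0))
    (hρanti : AntitoneOn ρ (Set.Ici 0))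
    (hρint : Integrable (fun x : EuclideanSpace ℝ (Fin n) => ρ (‖x‖ ^ 2)))
    (hρconv : ConvexOn ℝ Set.univ (fun t : ℝ => -Real.log (ρ (Real.exp t))))
    (μρ : Measure (EuclideanSpace ℝ (Fin n)))
    (hμρ : μρ = volume.withDensity (fun x =>
      ENNReal.ofReal (ρ (‖x‖ ^ 2) / ∫ y : EuclideanSpace ℝ (Fin n), ρ (‖y‖ ^ 2))))
    (ν₁ ν₂ : Measure (EuclideanSpace ℝ (Fin n)))
    [IsProbabilityMeasure ν₁] [IsProbabilityMeasure ν₂]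
    (hν₁sym : ν₁.map (fun x => -x) = ν₁) (hν₂sym : ν₂.map (fun x => -x) = ν₂) :
    transportCost
      (fun x y => if 0 ≤ ⟪x, y⟫ then
          ENNReal.ofReal (Real.log (ρ ⟪x, y⟫ ^ 2 / (ρ (‖x‖ ^ 2) * ρ (‖y‖ ^ 2))))
        else ⊤) ν₁ ν₂
      ≤ relEnt ν₁ μρ + relEnt ν₂ μρ := by
  by_cases hH₁ : ν₁ ≪ μρ ∧ Integrable (llr ν₁ μρ) ν₁
  swap
  · rw [relEnt, if_neg hH₁, top_add]
    exact le_top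
  by_cases hH₂ : ν₂ ≪ μρ ∧ Integrable (llr ν₂ μρ) ν₂
  swap
  · rw [relEnt, relEnt, if_neg hH₂, add_top]
    exact le_top
  have hμp : IsProbabilityMeasure μρ := hμρ ▸ isProbabilityMeasure_radial hρpos hρint
  have hN₁ := InformationTheory.integral_llr_add_sub_measure_univ_nonneg hH₁.1 hH₁.2
  have hN₂ := InformationTheory.integral_llr_add_sub_measure_univ_nonneg hH₂.1 hH₂.2
  simp only [probReal_univ, add_sub_cancel_right] at hN₁ hN₂
  rw [relEnt, relEnt, if_pos hH₁, if_pos hH₂, ← ENNReal.ofReal_add hN₁ hN₂]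
  have hpos : ∀ x : EuclideanSpace ℝ (Fin n), 0 < ρ (‖x‖ ^ 2) := fun x => hρpos _ (sq_nonneg _)
  have hw0 : ∀ (x y : EuclideanSpace ℝ (Fin n)) {r : ℝ}, 0 ≤ r → r ≤ ‖x‖ * ‖y‖ →
      0 ≤ Real.log (ρ r ^ 2 / (ρ (‖x‖ ^ 2) * ρ (‖y‖ ^ 2))) := fun x y r hr hrxy =>
    Real.log_nonneg ((one_le_div (mul_pos (hpos x) (hpos y))).2
      (mul_le_sq_of_convexOn_neg_log_exp hρpos hρanti hρconv (norm_nonneg _) (norm_nonneg _) hr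
        hrxy))
  obtain ⟨π, hπ, hπfin, hπle⟩ := exists_coupling_integral_le ν₁ ν₂ (fun x y => if 0 ≤ ⟪x, y⟫ then
      ENNReal.ofReal (Real.log (ρ ⟪x, y⟫ ^ 2 / (ρ (‖x‖ ^ 2) * ρ (‖y‖ ^ 2)))) else ⊤) _ fun φ ψ hφψ =>
    integral_add_integral_le_of_admissible hρpos hρanti hρint hμρ hν₁sym hν₂sym hH₁.1 hH₁.2
      hH₂.1 hH₂.2 φ ψ fun x y hxy => by
        have h1 := hφψ x y
        rw [if_pos hxy] at h1
        exact (ENNReal.ofReal_le_ofReal_iff (hw0 x y hxy (real_inner_le_norm x y))).1 h1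
  refine (iInf₂_le π hπ).trans ?_
  have hσ : Continuous fun t => ρ (max t 0) :=
    hρcont.comp_continuous (by fun_prop) fun t => le_max_right t 0
  have hσnorm : Continuous fun x : EuclideanSpace ℝ (Fin n) => ρ (‖x‖ ^ 2) :=
    hρcont.comp_continuous (by fun_prop) fun x => sq_nonneg ‖x‖
  have hcost : ∀ x y : EuclideanSpace ℝ (Fin n), (if 0 ≤ ⟪x, y⟫ then
        ENNReal.ofReal (Real.log (ρ ⟪x, y⟫ ^ 2 / (ρ (‖x‖ ^ 2) * ρ (‖y‖ ^ 2)))) else ⊤)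
      = if 0 ≤ ⟪x, y⟫ then ENNReal.ofReal
        (Real.log (ρ (max ⟪x, y⟫ 0) ^ 2 / (ρ (‖x‖ ^ 2) * ρ (‖y‖ ^ 2)))) else ⊤ := by
    intro x y
    split_ifs with hxy
    · rw [max_eq_left hxy]
    · rfl
  simp only [hcost] at hπle ⊢
  refine lintegral_le_of_forall_boundedContinuous_le
    (w := fun p => Real.log (ρ (max ⟪p.1, p.2⟫ 0) ^ 2 / (ρ (‖p.1‖ ^ 2) * ρ (‖p.2‖ ^ 2))))
    (q := fun p => ⟪p.1, p.2⟫) ?_ (by fun_prop) (fun p => ?_)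
    fun u hu => hπle u fun x y => hu (x, y)
  · refine Continuous.log (Continuous.div ?_ ?_ fun p => ?_) fun p => ?_
    · exact (hσ.comp (by fun_prop : Continuous fun p : EuclideanSpace ℝ (Fin n) ×
        EuclideanSpace ℝ (Fin n) => ⟪p.1, p.2⟫)).pow 2
    · exact (hσnorm.comp continuous_fst).mul (hσnorm.comp continuous_snd)
    · exact (mul_pos (hpos _) (hpos _)).ne'
    · exact (div_pos (pow_pos (hρpos _ (le_max_right _ _)) 2) (mul_pos (hpos _) (hpos _))).ne'
  · exact hw0 _ _ (le_max_right _ _) (max_le (real_inner_le_norm _ _)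
      (mul_nonneg (norm_nonneg _) (norm_nonneg _)))
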